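/- arXiv:1101.5382 — 2 statements merged into one kernel-verified Lean document; each statement's English description precedes it below -/
import Mathlib

section
/- Every root β in the cascade ℬ is locally high, i.e. β is the highest root of the root subsystem Δ(β) determined by its support. -/
open scoped InnerProductSpace BigOperators

structure RootSystemData (V : Type*) [NormedAddCommGroup V] [InnerProductSpace ℝ V] where
  Δ : Set V
  finite : Δ.Finite
  span_top : Submodule.span ℝ Δ = ⊤
  zero_not_mem : (0 : V) ∉ Δ
  neg_mem : ∀ α ∈ Δ, -α ∈ Δ
  reduced : ∀ α ∈ Δ, ∀ t : ℝ, t • α ∈ Δ → t = 1 ∨ t = -1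
  crystal : ∀ α ∈ Δ, ∀ β ∈ Δ, ∃ n : ℤ, 2 * ⟪α, β⟫_ℝ = (n : ℝ) * ⟪β, β⟫_ℝ
  reflect_mem : ∀ α ∈ Δ, ∀ β ∈ Δ, α - (2 * ⟪α, β⟫_ℝ / ⟪β, β⟫_ℝ) • β ∈ Δ
  Pos : Set V
  pos_subset : Pos ⊆ Δ
  mem_or_neg : ∀ α ∈ Δ, α ∈ Pos ∨ -α ∈ Pos
  not_neg_mem : ∀ α ∈ Pos, -α ∉ Pos
  pos_add : ∀ α ∈ Pos, ∀ β ∈ Pos, α + β ∈ Δ → α + β ∈ Pos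

namespace RootSystemData

variable {V : Type*} [NormedAddCommGroup V] [InnerProductSpace ℝ V] (R : RootSystemData V)

/-- The set of simple roots: indecomposable positive roots. -/
def Simple : Set V := {α ∈ R.Pos | ¬ ∃ β ∈ R.Pos, ∃ γ ∈ R.Pos, α = β + γ}

/-- The support `Π(φ)` of a positive root: the simple roots needed to express `φ`. -/
def support (φ : V) : Set V := {α ∈ R.Simple | φ ∉ Submodule.span ℝ (R.Simple \ {α})}

/-- The root subsystem `Δ(φ)`: all roots lying in the span of the support of `φ`. -/
def sub (φ : V) : Set V := {ψ ∈ R.Δ | ψ ∈ Submodule.span ℝ (R.support φ)}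

/-- The positive roots `Δ(φ)₊` of the subsystem `Δ(φ)`. -/
def posSub (φ : V) : Set V := R.sub φ ∩ R.Pos

/-- `x` is a nonnegative integer combination of positive roots. -/
def NonnegComb (x : V) : Prop :=
  ∃ c : V →₀ ℕ, ↑c.support ⊆ R.Pos ∧ x = c.sum fun α n => (n : ℝ) • α

/-- `β` is the highest root of the subset `S`. -/
def IsHighest (S : Set V) (β : V) : Prop :=
  β ∈ S ∧ β ∈ R.Pos ∧ ∀ ψ ∈ S, R.NonnegComb (β - ψ)

/-- `β` is locally high: it is the highest root of `Δ(β)`. -/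
def LocallyHigh (β : V) : Prop := β ∈ R.Pos ∧ R.IsHighest (R.sub β) β

/-- `E(β) = {φ ∈ Δ(β) : (φ,β) > 0}`. -/
def E (β : V) : Set V := {φ ∈ R.sub β | 0 < ⟪φ, β⟫_ℝ}

/-- `Δ(β)° = {φ ∈ Δ(β) : (φ,β) = 0}`. -/
def orth (β : V) : Set V := {φ ∈ R.sub β | ⟪φ, β⟫_ℝ = 0}

/-- Strong orthogonality of two roots. -/
def StronglyOrth (φ ψ : V) : Prop := φ + ψ ∉ R.Δ ∧ φ - ψ ∉ R.Δ


/-- Half the sum of the positive roots of `Δ(β)`. -/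
noncomputable def rho (β : V) : V := (2⁻¹ : ℝ) • ∑ᶠ φ ∈ R.posSub β, φ

/-- The dual Coxeter number of `Δ(β)`, `⟨ρ_β, β^∨⟩ + 1`. -/
noncomputable def dualCoxeter (β : V) : ℝ := 2 * ⟪R.rho β, β⟫_ℝ / ⟪β, β⟫_ℝ + 1

end RootSystemData

/-- A finite set of vectors is irreducible if it is nonempty and admits no splitting into
two nonempty mutually orthogonal pieces. -/
def IsIrred {V : Type*} [NormedAddCommGroup V] [InnerProductSpace ℝ V] (S : Set V) : Prop :=
  S.Nonempty ∧ ¬ ∃ A B : Set V, A ∪ B = S ∧ A ∩ B = ∅ ∧ A.Nonempty ∧ B.Nonempty ∧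
    ∀ a ∈ A, ∀ b ∈ B, ⟪a, b⟫_ℝ = 0

/-- `C` is an irreducible component of `S`. -/
def IsComponent {V : Type*} [NormedAddCommGroup V] [InnerProductSpace ℝ V]
    (S C : Set V) : Prop :=
  C ⊆ S ∧ IsIrred C ∧ ∀ a ∈ C, ∀ b ∈ S \ C, ⟪a, b⟫_ℝ = 0

/-- The reflection `s_β` in the (co)vector `β`. -/
noncomputable def reflectRoot {V : Type*} [NormedAddCommGroup V] [InnerProductSpace ℝ V]
    (β v : V) : V := v - (2 * ⟪v, β⟫_ℝ / ⟪β, β⟫_ℝ) • β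

namespace RootSystemData

variable {V : Type*} [NormedAddCommGroup V] [InnerProductSpace ℝ V] (R : RootSystemData V)

/-- A chain cascade: a nonempty list whose head is the highest root of an irreducible
component of `Δ`, and each subsequent entry is the highest root of an irreducible component
of `Δ(previous)°`. -/
def IsChainCascade (l : List V) : Prop :=
  l ≠ [] ∧
  (∀ b ∈ l.head?, ∃ C, IsComponent R.Δ C ∧ R.IsHighest C b) ∧
  l.Chain' fun γ δ => ∃ C, IsComponent (R.orth γ) C ∧ R.IsHighest C δ

/-- The cascade `ℬ` of roots: all positive roots belonging to some chain cascade. -/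
def cascade : Set V := {β | ∃ l, R.IsChainCascade l ∧ β ∈ l}

/-- `l` is the chain cascade `C(φ)` associated to the positive root `φ`. -/
def IsCascadeChainOf (φ : V) (l : List V) : Prop :=
  R.IsChainCascade l ∧ (∀ β ∈ l, φ ∈ R.sub β) ∧
  (∀ β ∈ l.dropLast, ⟪φ, β⟫_ℝ = 0) ∧ ∀ β ∈ l.getLast?, 0 < ⟪φ, β⟫_ℝ

end RootSystemData

namespace RootSystemData

variable {V : Type*} [NormedAddCommGroup V] [InnerProductSpace ℝ V] (R : RootSystemData V)

lemma inner_self_pos {a : V} (ha : a ∈ R.Δ) : 0 < ⟪a, a⟫_ℝ :=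
  real_inner_self_pos.2 fun h => R.zero_not_mem (h ▸ ha)

/-- If two roots form an obtuse angle, their sum is a root or zero. -/
lemma add_mem_of_inner_neg {a b : V} (ha : a ∈ R.Δ) (hb : b ∈ R.Δ) (h : ⟪a, b⟫_ℝ < 0)
    (hab : a + b ≠ 0) : a + b ∈ R.Δ := by
  have step : ∀ {x y : V}, x ∈ R.Δ → y ∈ R.Δ → ⟪x, y⟫_ℝ < 0 →
      x + y ∈ R.Δ ∨ 2 * ⟪x, y⟫_ℝ ≤ -2 * ⟪y, y⟫_ℝ := by
    intro x y hx hy hxy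
    obtain ⟨n, hn⟩ := R.crystal x hx y hy
    have hyy := R.inner_self_pos hy
    have hn0 : n < 0 := by
      by_contra hc
      have : (0 : ℝ) ≤ n := by exact_mod_cast not_lt.1 hc
      nlinarith
    rcases eq_or_ne n (-1) with rfl | hne
    · left
      have h := R.reflect_mem x hx y hy
      rw [hn, mul_div_assoc, div_self hyy.ne'] at h
      simpa using h
    · right
      have : (n : ℝ) ≤ -2 := by exact_mod_cast (by omega : n ≤ -2)
      rw [hn]
      exact mul_le_mul_of_nonneg_right this hyy.le
  rcases step ha hb h with h1 | h1
  · exact h1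
  rcases step hb ha (by rwa [real_inner_comm]) with h2 | h2
  · rwa [add_comm]
  · have := real_inner_self_pos.2 hab
    rw [real_inner_add_add_self] at this
    rw [real_inner_comm] at h2
    linarith

lemma sum_ne_zero (m : Multiset V) (hm : ∀ a ∈ m, a ∈ R.Pos) (h0 : m ≠ 0) : m.sum ≠ 0 := by
  induction hn : m.card using Nat.strong_induction_on generalizing m with
  | _ n ih =>
  intro hs
  obtain ⟨a, ha⟩ := Multiset.exists_mem_of_ne_zero h0
  obtain ⟨t, rfl⟩ := Multiset.exists_cons_of_mem ha
  have haΔ := R.pos_subset (hm a ha)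
  have : ∃ b ∈ t, ⟪a, b⟫_ℝ < 0 := by
    by_contra! hc
    have h1 : 0 ≤ ⟪a, t.sum⟫_ℝ := by
      have : ⟪a, t.sum⟫_ℝ = (t.map fun b => ⟪a, b⟫_ℝ).sum :=
        map_multiset_sum (innerₗ V a) t
      rw [this]
      refine Multiset.sum_nonneg fun x hx => ?_
      obtain ⟨b, hb, rfl⟩ := Multiset.mem_map.1 hx
      exact hc b hb
    rw [Multiset.sum_cons] at hs
    rw [← neg_eq_of_add_eq_zero_right hs, inner_neg_right] at h1
    linarith [R.inner_self_pos haΔ]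
  obtain ⟨b, hb, hab⟩ := this
  obtain ⟨t, rfl⟩ := Multiset.exists_cons_of_mem hb
  have hbP : b ∈ R.Pos := hm b (by simp)
  have hab0 : a + b ≠ 0 := fun h =>
    R.not_neg_mem a (hm a ha) (neg_eq_of_add_eq_zero_right h ▸ hbP)
  have habP := R.pos_add a (hm a ha) b hbP
    (R.add_mem_of_inner_neg haΔ (R.pos_subset hbP) hab hab0)
  refine ih (t.card + 1) (by simp [← hn]) ((a + b) ::ₘ t) ?_ (by simp) (by simp) ?_
  · intro x hx
    rcases Multiset.mem_cons.1 hx with rfl | hx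
    · exact habP
    · exact hm x (by simp [hx])
  · simpa [add_assoc] using hs

/-- The monoid of sums of positive roots contains no pair of opposite nonzero vectors. -/
lemma eq_zero_of_mem_closure {x : V} (hx : x ∈ AddSubmonoid.closure R.Pos)
    (hx' : -x ∈ AddSubmonoid.closure R.Pos) : x = 0 := by
  obtain ⟨m, hm, rfl⟩ := AddSubmonoid.exists_multiset_of_mem_closure hx
  obtain ⟨m', hm', h⟩ := AddSubmonoid.exists_multiset_of_mem_closure hx'
  by_contra hne
  refine R.sum_ne_zero (m + m') ?_ ?_ (by simp [h])
  · intro a ha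
    rcases Multiset.mem_add.1 ha with ha | ha
    exacts [hm a ha, hm' a ha]
  · rintro h0
    apply hne
    rw [(add_eq_zero.1 h0).1, Multiset.sum_zero]

lemma pos_ne_zero {a : V} (ha : a ∈ R.Pos) : a ≠ 0 :=
  fun h => R.zero_not_mem (h ▸ R.pos_subset ha)

lemma pos_subset_closure_simple : R.Pos ⊆ AddSubmonoid.closure R.Simple := by
  let r : V → V → Prop := fun x y => y - x ∈ AddSubmonoid.closure R.Pos ∧ x ≠ y
  have : IsStrictOrder V r :=
    { irrefl := fun x h => h.2 rfl
      trans := by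
        rintro x y z ⟨h1, n1⟩ ⟨h2, _⟩
        refine ⟨by simpa using add_mem h2 h1, ?_⟩
        rintro rfl
        exact n1 (sub_eq_zero.1 (R.eq_zero_of_mem_closure h1 (by simpa using h2))).symm }
  have wf : R.Pos.WellFoundedOn r := (R.finite.subset R.pos_subset).wellFoundedOn
  intro φ hφ
  refine wf.induction (P := fun φ => φ ∈ AddSubmonoid.closure R.Simple) hφ ?_
  intro y hy ih
  by_cases hs : y ∈ R.Simple
  · exact AddSubmonoid.subset_closure hs
  have : ∃ β ∈ R.Pos, ∃ γ ∈ R.Pos, y = β + γ := by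
    by_contra hc
    exact hs ⟨hy, hc⟩
  obtain ⟨β, hβ, γ, hγ, rfl⟩ := this
  refine add_mem (ih β hβ ⟨?_, ?_⟩) (ih γ hγ ⟨?_, ?_⟩)
  · simpa using AddSubmonoid.subset_closure hγ
  · simpa using R.pos_ne_zero hγ
  · simpa using AddSubmonoid.subset_closure hβ
  · simpa using R.pos_ne_zero hβ

lemma simple_subset_pos : R.Simple ⊆ R.Pos := fun _ h => h.1

lemma inner_simple_nonpos {a b : V} (ha : a ∈ R.Simple) (hb : b ∈ R.Simple) (hab : a ≠ b) :
    ⟪a, b⟫_ℝ ≤ 0 := by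
  by_contra! hc
  have haΔ := R.pos_subset ha.1
  have hbΔ := R.pos_subset hb.1
  have h : a + -b ∈ R.Δ := R.add_mem_of_inner_neg haΔ (R.neg_mem b hbΔ)
    (by rw [inner_neg_right]; linarith) (by simpa [← sub_eq_add_neg, sub_eq_zero] using hab)
  rcases R.mem_or_neg _ h with h | h
  · exact ha.2 ⟨_, h, b, hb.1, by simp⟩
  · exact hb.2 ⟨_, h, a, ha.1, by simp⟩

lemma nat_coeff_eq_zero [Fintype R.Simple] (n : R.Simple → ℕ)
    (h : ∑ a, n a • (a : V) = 0) : n = 0 := by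
  classical
  have hmem : ∀ a : R.Simple, n a • (a : V) ∈ AddSubmonoid.closure R.Pos := fun a =>
    nsmul_mem (AddSubmonoid.subset_closure a.2.1) _
  funext a
  have h' := Finset.add_sum_erase Finset.univ (fun a : R.Simple => n a • (a : V))
    (Finset.mem_univ a)
  rw [h] at h'
  have h0 := R.eq_zero_of_mem_closure (hmem a) (by
    rw [neg_eq_of_add_eq_zero_right h']
    exact sum_mem fun b _ => hmem b)
  rw [← Nat.cast_smul_eq_nsmul ℝ] at h0
  exact_mod_cast (smul_eq_zero.1 h0).resolve_right (R.pos_ne_zero a.2.1)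

lemma int_coeff_eq_zero [Fintype R.Simple] (z : R.Simple → ℤ)
    (h : ∑ a, z a • (a : V) = 0) : z = 0 := by
  have hsplit : ∀ a, z a = ((z a).toNat : ℤ) - ((-z a).toNat : ℤ) := fun a => by omega
  have heq : ∑ a, (z a).toNat • (a : V) = ∑ a, (-z a).toNat • (a : V) := by
    rw [← sub_eq_zero, ← Finset.sum_sub_distrib, ← h]
    refine Finset.sum_congr rfl fun a _ => ?_
    conv_rhs => rw [hsplit a, sub_smul, natCast_zsmul, natCast_zsmul]
  have hle : ⟪∑ a, (z a).toNat • (a : V), ∑ a, (-z a).toNat • (a : V)⟫_ℝ ≤ 0 := by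
    rw [sum_inner]
    refine Finset.sum_nonpos fun a _ => ?_
    rw [inner_sum]
    refine Finset.sum_nonpos fun b _ => ?_
    rw [← Nat.cast_smul_eq_nsmul ℝ, ← Nat.cast_smul_eq_nsmul ℝ, real_inner_smul_left,
      real_inner_smul_right]
    by_cases hab : a = b
    · subst hab
      rcases le_total (z a) 0 with h0 | h0
      · simp [Int.toNat_of_nonpos h0]
      · simp [Int.toNat_of_nonpos (neg_nonpos.2 h0)]
    · have := R.inner_simple_nonpos a.2 b.2 (fun h => hab (Subtype.ext h))
      exact mul_nonpos_of_nonneg_of_nonpos (by positivity)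
        (mul_nonpos_of_nonneg_of_nonpos (by positivity) this)
  have hp : ∑ a, (z a).toNat • (a : V) = 0 := by
    rw [← heq] at hle
    exact inner_self_eq_zero (𝕜 := ℝ).1 (le_antisymm hle real_inner_self_nonneg)
  have h1 := R.nat_coeff_eq_zero _ hp
  have h2 := R.nat_coeff_eq_zero _ (heq ▸ hp)
  funext a
  rw [hsplit a]
  simp [congrFun h1 a, congrFun h2 a]

lemma linearIndepOn_simple : LinearIndepOn ℝ id R.Simple := by
  classical
  have : Fintype R.Simple :=
    (R.finite.subset (R.simple_subset_pos.trans R.pos_subset)).fintype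
  have hΔ : ∀ a : R.Simple, (a : V) ∈ R.Δ := fun a => R.pos_subset a.2.1
  choose M hM using fun b a : R.Simple => R.crystal a (hΔ a) b (hΔ b)
  let A : Matrix R.Simple R.Simple ℤ := Matrix.of M
  rw [LinearIndepOn, Fintype.linearIndependent_iff]
  intro c hc
  by_contra! hne
  have hdetR : (A.map (Int.castRingHom ℝ)).det = 0 := by
    refine Matrix.exists_mulVec_eq_zero_iff.1 ⟨c, fun h => ?_, ?_⟩
    · obtain ⟨i, hi⟩ := hne
      exact hi (congrFun h i)
    · funext b
      have h0 : 2 * ⟪∑ a, c a • (a : V), (b : V)⟫_ℝ = 0 := by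
        rw [show ∑ a, c a • (a : V) = 0 from hc]; simp
      rw [sum_inner, Finset.mul_sum] at h0
      have h1 : (∑ a, (M b a : ℝ) * c a) * ⟪(b : V), (b : V)⟫_ℝ = 0 := by
        rw [Finset.sum_mul, ← h0]
        refine Finset.sum_congr rfl fun a _ => ?_
        rw [real_inner_smul_left, mul_left_comm, hM b a]
        ring
      exact (mul_eq_zero.1 h1).resolve_right (R.inner_self_pos (hΔ b)).ne'
  have hdet : A.det = 0 := by
    have : (Int.castRingHom ℝ) A.det = 0 := by rw [RingHom.map_det]; exact hdetR
    simpa using this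
  obtain ⟨z, hz0, hz⟩ := Matrix.exists_mulVec_eq_zero_iff.2 hdet
  refine hz0 (R.int_coeff_eq_zero z ?_)
  have horth : ∀ b : R.Simple, ⟪∑ a, z a • (a : V), (b : V)⟫_ℝ = 0 := by
    intro b
    have h0 : ∑ a, (M b a : ℝ) * z a = 0 := by exact_mod_cast congrFun hz b
    have : 2 * ⟪∑ a, z a • (a : V), (b : V)⟫_ℝ
        = (∑ a, (M b a : ℝ) * z a) * ⟪(b : V), (b : V)⟫_ℝ := by
      rw [sum_inner, Finset.mul_sum, Finset.sum_mul]
      refine Finset.sum_congr rfl fun a _ => ?_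
      rw [← Int.cast_smul_eq_zsmul ℝ, real_inner_smul_left, mul_left_comm, hM b a]
      ring
    rw [h0] at this
    linarith
  refine inner_self_eq_zero (𝕜 := ℝ).1 ?_
  rw [inner_sum]
  refine Finset.sum_eq_zero fun b _ => ?_
  rw [← Int.cast_smul_eq_zsmul ℝ, real_inner_smul_right, horth b, mul_zero]

/-- A positive root is a nonnegative combination of simple roots. -/
lemma exists_simple_repr {φ : V} (hφ : φ ∈ R.Pos) :
    ∃ c : V →₀ ℝ, c ∈ Finsupp.supported ℝ ℝ R.Simple ∧ 0 ≤ c ∧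
      Finsupp.linearCombination ℝ id c = φ := by
  refine AddSubmonoid.closure_induction
    (motive := fun x _ => ∃ c : V →₀ ℝ, c ∈ Finsupp.supported ℝ ℝ R.Simple ∧ 0 ≤ c ∧
      Finsupp.linearCombination ℝ id c = x) ?_ ?_ ?_ (R.pos_subset_closure_simple hφ)
  · intro x hx
    exact ⟨Finsupp.single x 1, Finsupp.single_mem_supported ℝ 1 hx,
      Finsupp.single_nonneg.2 zero_le_one, by simp⟩
  · exact ⟨0, zero_mem _, le_rfl, by simp⟩
  · rintro x y _ _ ⟨c, hc, hc0, rfl⟩ ⟨d, hd, hd0, rfl⟩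
    exact ⟨c + d, add_mem hc hd, add_nonneg hc0 hd0, map_add _ _ _⟩

/-- Coefficients of a vector on simple roots live on any set of simple roots spanning it. -/
lemma mem_supported_of_mem_span {T : Set V} (hT : T ⊆ R.Simple) {c : V →₀ ℝ}
    (hc : c ∈ Finsupp.supported ℝ ℝ R.Simple)
    (h : Finsupp.linearCombination ℝ id c ∈ Submodule.span ℝ T) :
    c ∈ Finsupp.supported ℝ ℝ T := by
  rw [← Set.image_id T, Finsupp.mem_span_image_iff_linearCombination] at h
  obtain ⟨l, hl, hlc⟩ := h
  have := linearIndepOn_iffₛ.1 R.linearIndepOn_simple l (Finsupp.supported_mono hT hl) c hc hlc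
  exact this ▸ hl

lemma mem_span_support {φ : V} (hφ : φ ∈ R.Pos) : φ ∈ Submodule.span ℝ (R.support φ) := by
  obtain ⟨c, hc, -, h⟩ := R.exists_simple_repr hφ
  rw [← Set.image_id (R.support φ), Finsupp.mem_span_image_iff_linearCombination]
  refine ⟨c, fun a ha => ⟨hc ha, fun hmem => ?_⟩, h⟩
  rw [← h] at hmem
  exact (R.mem_supported_of_mem_span Set.sdiff_subset hc hmem ha).2 rfl

lemma mem_sub_self {φ : V} (hφ : φ ∈ R.Pos) : φ ∈ R.sub φ :=
  ⟨R.pos_subset hφ, R.mem_span_support hφ⟩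

lemma support_subset_simple (φ : V) : R.support φ ⊆ R.Simple := fun _ h => h.1

variable {R}

lemma NonnegComb.mem_closure {x : V} (h : R.NonnegComb x) : x ∈ AddSubmonoid.closure R.Pos := by
  obtain ⟨c, hc, rfl⟩ := h
  refine sum_mem fun a ha => ?_
  simp only [Nat.cast_smul_eq_nsmul]
  exact nsmul_mem (AddSubmonoid.subset_closure (hc ha)) _

lemma LocallyHigh.inner_nonneg {γ α : V} (h : R.LocallyHigh γ) (hα : α ∈ R.support γ) :
    0 ≤ ⟪α, γ⟫_ℝ := by
  by_contra! hc
  have hαP : α ∈ R.Pos := hα.1.1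
  have hne : γ + α ≠ 0 := fun h0 =>
    R.not_neg_mem γ h.1 (neg_eq_of_add_eq_zero_right h0 ▸ hαP)
  have hmem : γ + α ∈ R.sub γ :=
    ⟨R.add_mem_of_inner_neg (R.pos_subset h.1) (R.pos_subset hαP)
      (by rwa [real_inner_comm]) hne,
      add_mem (R.mem_span_support h.1) (Submodule.subset_span hα)⟩
  have hneg := (h.2.2.2 _ hmem).mem_closure
  rw [sub_add_cancel_left] at hneg
  exact R.pos_ne_zero hαP (R.eq_zero_of_mem_closure (AddSubmonoid.subset_closure hαP) hneg)

/-- The highest root of an orthogonal piece `C` of `S` is locally high as soon as `S` contains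
every root in its span and positive roots in `S` are combinations of simple roots in `S`. -/
lemma IsHighest.locallyHigh {S C : Set V} (hS : ∀ ψ ∈ R.Δ, ψ ∈ Submodule.span ℝ S → ψ ∈ S)
    (hrepr : ∀ φ ∈ S, φ ∈ R.Pos → φ ∈ Submodule.span ℝ (R.Simple ∩ S))
    (hCS : C ⊆ S) (horth : ∀ a ∈ C, ∀ b ∈ S \ C, ⟪a, b⟫_ℝ = 0)
    {δ : V} (hδ : R.IsHighest C δ) : R.LocallyHigh δ := by
  obtain ⟨hδC, hδP, hhigh⟩ := hδ
  have horth' : ∀ x ∈ Submodule.span ℝ C, ∀ b ∈ S \ C, ⟪x, b⟫_ℝ = 0 := by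
    intro x hx b hb
    induction hx using Submodule.span_induction with
    | mem a ha => exact horth a ha b hb
    | zero => simp
    | add x y _ _ hx hy => rw [inner_add_left, hx, hy, add_zero]
    | smul t x _ hx => rw [real_inner_smul_left, hx, mul_zero]
  have hδspan : δ ∈ Submodule.span ℝ (R.Simple ∩ C) := by
    have h := hrepr δ (hCS hδC) hδP
    have hsplit : R.Simple ∩ S ⊆ (R.Simple ∩ C) ∪ (S \ C) := fun a ha => by
      by_cases haC : a ∈ C
      · exact Or.inl ⟨ha.1, haC⟩
      · exact Or.inr ⟨ha.2, haC⟩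
    have h := Submodule.span_mono hsplit h
    rw [Submodule.span_union] at h
    obtain ⟨x, hx, y, hy, hxy⟩ := Submodule.mem_sup.1 h
    have hyC : y ∈ Submodule.span ℝ C := by
      rw [← add_sub_cancel_left x y, hxy]
      exact sub_mem (Submodule.subset_span hδC) (Submodule.span_mono Set.inter_subset_right hx)
    have hyy : ∀ w ∈ Submodule.span ℝ (S \ C), ⟪y, w⟫_ℝ = 0 := by
      intro w hw
      induction hw using Submodule.span_induction with
      | mem b hb => exact horth' y hyC b hb
      | zero => simp
      | add u v _ _ hu hv => rw [inner_add_right, hu, hv, add_zero]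
      | smul t u _ hu => rw [real_inner_smul_right, hu, mul_zero]
    have hy0 : y = 0 := inner_self_eq_zero (𝕜 := ℝ).1 (hyy y hy)
    rw [← hxy, hy0, add_zero]
    exact hx
  have hsupp : R.support δ ⊆ C := by
    rintro α ⟨hα, hnot⟩
    by_contra hαC
    refine hnot (Submodule.span_mono ?_ hδspan)
    rintro a ⟨ha, haC⟩
    exact ⟨ha, fun h => hαC (h ▸ haC)⟩
  refine ⟨hδP, R.mem_sub_self hδP, hδP, fun ψ hψ => hhigh ψ ?_⟩
  have hψC := Submodule.span_mono (R := ℝ) hsupp hψ.2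
  by_contra hψnot
  have := horth' ψ hψC ψ ⟨hS ψ hψ.1 (Submodule.span_mono hCS hψC), hψnot⟩
  exact (R.inner_self_pos hψ.1).ne' this

lemma locallyHigh_of_isComponent {C : Set V} {δ : V} (hC : IsComponent R.Δ C)
    (hδ : R.IsHighest C δ) : R.LocallyHigh δ := by
  refine hδ.locallyHigh (fun ψ h _ => h) (fun φ _ hφ => ?_) hC.1 hC.2.2
  have hsub : R.support φ ⊆ R.Simple ∩ R.Δ := fun a ha => ⟨ha.1, R.pos_subset ha.1.1⟩
  exact Submodule.span_mono hsub (R.mem_span_support hφ)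

/-- A positive root of `Δ(γ)°` is a combination of simple roots in `Δ(γ)°`. -/
lemma LocallyHigh.mem_span_orth {γ φ : V} (hγ : R.LocallyHigh γ) (hφ : φ ∈ R.orth γ)
    (hφP : φ ∈ R.Pos) : φ ∈ Submodule.span ℝ (R.Simple ∩ R.orth γ) := by
  obtain ⟨c, hc, hc0, rfl⟩ := R.exists_simple_repr hφP
  have hcγ := R.mem_supported_of_mem_span (R.support_subset_simple γ) hc hφ.1.2
  have hsum : ∑ a ∈ c.support, c a * ⟪a, γ⟫_ℝ = 0 := by
    rw [← hφ.2, Finsupp.linearCombination_apply, Finsupp.sum, sum_inner]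
    simp [real_inner_smul_left]
  rw [Finset.sum_eq_zero_iff_of_nonneg fun a ha =>
    mul_nonneg (hc0 a) (hγ.inner_nonneg (hcγ ha))] at hsum
  refine sum_mem fun a ha => Submodule.smul_mem _ _ (Submodule.subset_span ?_)
  refine ⟨hc ha, ⟨R.pos_subset (hc ha).1, Submodule.subset_span (hcγ ha)⟩, ?_⟩
  exact (mul_eq_zero.1 (hsum a ha)).resolve_left (Finsupp.mem_support_iff.1 ha)

lemma mem_orth_of_mem_span {γ ψ : V} (hψ : ψ ∈ R.Δ)
    (h : ψ ∈ Submodule.span ℝ (R.orth γ)) : ψ ∈ R.orth γ := by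
  refine ⟨⟨hψ, Submodule.span_le.2 (fun a ha => ha.1.2) h⟩, ?_⟩
  clear hψ
  induction h using Submodule.span_induction with
  | mem a ha => exact ha.2
  | zero => simp
  | add x y _ _ hx hy => rw [inner_add_left, hx, hy, add_zero]
  | smul t x _ hx => rw [real_inner_smul_left, hx, mul_zero]

lemma LocallyHigh.of_isComponent_orth {γ δ : V} {C : Set V} (hγ : R.LocallyHigh γ)
    (hC : IsComponent (R.orth γ) C) (hδ : R.IsHighest C δ) : R.LocallyHigh δ :=
  hδ.locallyHigh (fun _ => mem_orth_of_mem_span) (fun _ => hγ.mem_span_orth) hC.1 hC.2.2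

lemma IsChainCascade.locallyHigh {l : List V} (hl : R.IsChainCascade l) :
    ∀ β ∈ l, R.LocallyHigh β := by
  obtain ⟨hne, hhead, hchain⟩ := hl
  have hstart : ∀ b ∈ l.head?, R.LocallyHigh b := fun b hb => by
    obtain ⟨C, hC, hb⟩ := hhead b hb
    exact locallyHigh_of_isComponent hC hb
  clear hhead hne
  induction l with
  | nil => simp
  | cons a t ih =>
    have ha : R.LocallyHigh a := hstart a (by simp)
    obtain ⟨hat, ht⟩ := List.isChain_cons.1 hchain
    intro β hβ
    rcases List.mem_cons.1 hβ with rfl | hβ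
    · exact ha
    · refine ih ht (fun b hb => ?_) β hβ
      obtain ⟨C, hC, hb⟩ := hat b hb
      exact ha.of_isComponent_orth hC hb

end RootSystemData

/-- Every root in the cascade `ℬ` is locally high, i.e. it is the highest
root of the root subsystem determined by its support. -/
theorem statement2 {V : Type*} [NormedAddCommGroup V] [InnerProductSpace ℝ V]
    (R : RootSystemData V) :
    ∀ β ∈ R.cascade, R.LocallyHigh β := by
  rintro β ⟨l, hl, hβ⟩
  exact hl.locallyHigh β hβ
end

section
/- For positive roots φ, φ′ one has C(φ) = C(φ′) if and only if there exists β ∈ ℬ such that φ, φ′ ∈ E(β), in which case β is the minimal (last) element of the chain cascade C(φ) = C(φ′). Consequently Δ₊ is the disjoint union over β ∈ ℬ of the sets E(β). -/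
open scoped InnerProductSpace BigOperators

namespace RootSystemData

variable {V : Type*} [NormedAddCommGroup V] [InnerProductSpace ℝ V] (R : RootSystemData V)

section Roots

lemma ne_zero {α : V} (h : α ∈ R.Δ) : α ≠ 0 := fun h0 => R.zero_not_mem (h0 ▸ h)

lemma add_mem_or_eq_zero {α β : V} (hα : α ∈ R.Δ) (hβ : β ∈ R.Δ) (h : ⟪α, β⟫_ℝ < 0) :
    α + β ∈ R.Δ ∨ α + β = 0 := by
  have hα0 : 0 < ⟪α, α⟫_ℝ := real_inner_self_pos.2 (R.ne_zero hα)
  have hβ0 : 0 < ⟪β, β⟫_ℝ := real_inner_self_pos.2 (R.ne_zero hβ)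
  have key : ∀ x ∈ R.Δ, ∀ y ∈ R.Δ, ∀ n : ℤ, 2 * ⟪x, y⟫_ℝ = (n : ℝ) * ⟪y, y⟫_ℝ →
      ⟪x, y⟫_ℝ < 0 → 0 < ⟪y, y⟫_ℝ → x + y ∈ R.Δ ∨ 2 * ⟪x, y⟫_ℝ ≤ -2 * ⟪y, y⟫_ℝ := by
    intro x hx y hy n hn hneg hpos
    have hn0 : n < 0 := by
      by_contra! hc
      have : (0 : ℝ) ≤ n := by exact_mod_cast hc
      nlinarith
    rcases eq_or_ne n (-1) with rfl | hne
    · left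
      have := R.reflect_mem x hx y hy
      rw [hn, mul_div_cancel_right₀ _ hpos.ne'] at this
      simpa using this
    · right
      have : (n : ℝ) ≤ -2 := by exact_mod_cast (by omega : n ≤ -2)
      nlinarith
  obtain ⟨n, hn⟩ := R.crystal α hα β hβ
  obtain ⟨m, hm⟩ := R.crystal β hβ α hα
  rcases key α hα β hβ n hn h hβ0 with h1 | h1
  · exact Or.inl h1
  rcases key β hβ α hα m hm (by rwa [real_inner_comm]) hα0 with h2 | h2
  · left; rwa [add_comm]
  right
  rw [real_inner_comm] at h2
  have : ⟪α + β, α + β⟫_ℝ ≤ 0 := by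
    rw [real_inner_add_add_self]; linarith
  exact real_inner_self_nonpos.1 this

lemma add_mem_pos {α β : V} (hα : α ∈ R.Pos) (hβ : β ∈ R.Pos) (h : ⟪α, β⟫_ℝ < 0) :
    α + β ∈ R.Pos := by
  rcases R.add_mem_or_eq_zero (R.pos_subset hα) (R.pos_subset hβ) h with h1 | h1
  · exact R.pos_add α hα β hβ h1
  · exact absurd (by rwa [← neg_eq_of_add_eq_zero_right h1] at hβ) (R.not_neg_mem α hα)

lemma add_add_nsmul_ne_zero {φ : V} (hφ : φ ∈ R.Pos) (m : ℕ) :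
    ∀ β ∈ R.Pos, ∀ γ ∈ R.Pos, β + γ + m • φ ≠ 0 := by
  induction m with
  | zero =>
    intro β hβ γ hγ h
    rw [zero_smul, add_zero] at h
    rw [← neg_eq_of_add_eq_zero_right h] at hγ
    exact R.not_neg_mem β hβ hγ
  | succ m ih =>
    intro β hβ γ hγ h
    have hφ0 : 0 < ⟪φ, φ⟫_ℝ := real_inner_self_pos.2 (R.ne_zero (R.pos_subset hφ))
    have hsum : ⟪β, φ⟫_ℝ + ⟪γ, φ⟫_ℝ < 0 := by
      have h0 : ⟪β + γ + (m + 1) • φ, φ⟫_ℝ = 0 := by rw [h, inner_zero_left]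
      rw [← Nat.cast_smul_eq_nsmul ℝ, inner_add_left, inner_add_left, real_inner_smul_left] at h0
      have : (0 : ℝ) < ((m + 1 : ℕ) : ℝ) := by positivity
      nlinarith
    rcases lt_or_ge ⟪β, φ⟫_ℝ 0 with h1 | h1
    · refine ih _ (R.add_mem_pos hβ hφ h1) γ hγ ?_
      rw [← h, succ_nsmul]; abel
    · refine ih β hβ _ (R.add_mem_pos hγ hφ (by linarith)) ?_
      rw [← h, succ_nsmul]; abel

lemma inner_pos_of_reflect_not_mem {φ β : V} (hφ : φ ∈ R.Pos) (hβ : β ∈ R.Pos)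
    (h : β - (2 * ⟪β, φ⟫_ℝ / ⟪φ, φ⟫_ℝ) • φ ∉ R.Pos) : 0 < ⟪β, φ⟫_ℝ := by
  by_contra! hle
  have hφ0 : 0 < ⟪φ, φ⟫_ℝ := real_inner_self_pos.2 (R.ne_zero (R.pos_subset hφ))
  have hroot := R.reflect_mem β (R.pos_subset hβ) φ (R.pos_subset hφ)
  obtain ⟨n, hn⟩ := R.crystal β (R.pos_subset hβ) φ (R.pos_subset hφ)
  rw [hn, mul_div_cancel_right₀ _ hφ0.ne'] at h hroot
  have hn0 : n ≤ 0 := by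
    by_contra! hc
    have : (0 : ℝ) < n := by exact_mod_cast hc
    nlinarith
  have hneg := (R.mem_or_neg _ hroot).resolve_left h
  obtain ⟨m, rfl⟩ : ∃ m : ℕ, n = -m := ⟨n.natAbs, by omega⟩
  refine R.add_add_nsmul_ne_zero hφ m β hβ _ hneg ?_
  rw [← Nat.cast_smul_eq_nsmul ℝ]
  push_cast
  module

/-- The sum of all positive roots. -/
noncomputable def posSum : V := ∑ φ ∈ (R.finite.subset R.pos_subset).toFinset, φ

lemma reflect_involutive {φ : V} (hφ : φ ∈ R.Δ) (β : V) :
    (β - (2 * ⟪β, φ⟫_ℝ / ⟪φ, φ⟫_ℝ) • φ) - (2 * ⟪β - (2 * ⟪β, φ⟫_ℝ / ⟪φ, φ⟫_ℝ) • φ, φ⟫_ℝ /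
      ⟪φ, φ⟫_ℝ) • φ = β := by
  have hφ0 : ⟪φ, φ⟫_ℝ ≠ 0 := (real_inner_self_pos.2 (R.ne_zero hφ)).ne'
  rw [inner_sub_left, real_inner_smul_left]
  have : 2 * (⟪β, φ⟫_ℝ - 2 * ⟪β, φ⟫_ℝ / ⟪φ, φ⟫_ℝ * ⟪φ, φ⟫_ℝ) / ⟪φ, φ⟫_ℝ =
      -(2 * ⟪β, φ⟫_ℝ / ⟪φ, φ⟫_ℝ) := by
    field_simp; ring
  rw [this]; module

lemma posSum_pos {φ : V} (hφ : φ ∈ R.Pos) : 0 < ⟪R.posSum, φ⟫_ℝ := by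
  classical
  have hφ0 : 0 < ⟪φ, φ⟫_ℝ := real_inner_self_pos.2 (R.ne_zero (R.pos_subset hφ))
  rw [posSum, sum_inner, ← Finset.sum_filter_add_sum_filter_not _
    (fun β => β - (2 * ⟪β, φ⟫_ℝ / ⟪φ, φ⟫_ℝ) • φ ∈ R.Pos)]
  have hrefl : ∀ β : V, ⟪β - (2 * ⟪β, φ⟫_ℝ / ⟪φ, φ⟫_ℝ) • φ, φ⟫_ℝ = -⟪β, φ⟫_ℝ := by
    intro β
    rw [inner_sub_left, real_inner_smul_left]
    field_simp; ring
  have h1 : ∑ β ∈ (R.finite.subset R.pos_subset).toFinset with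
      β - (2 * ⟪β, φ⟫_ℝ / ⟪φ, φ⟫_ℝ) • φ ∈ R.Pos, ⟪β, φ⟫_ℝ = 0 := by
    refine Finset.sum_involution (fun β _ => β - (2 * ⟪β, φ⟫_ℝ / ⟪φ, φ⟫_ℝ) • φ) ?_ ?_ ?_ ?_
    · intro β _
      rw [hrefl]; ring
    · intro β _ hne heq
      have := hrefl β
      rw [heq] at this
      exact hne (by linarith)
    · intro β hβ
      simp only [Finset.mem_filter, Set.Finite.mem_toFinset] at hβ ⊢
      refine ⟨hβ.2, ?_⟩
      rw [R.reflect_involutive (R.pos_subset hφ)]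
      exact hβ.1
    · intro β _
      exact R.reflect_involutive (R.pos_subset hφ) β
  rw [h1, zero_add]
  refine Finset.sum_pos (fun β hβ => ?_) ⟨φ, ?_⟩
  · simp only [Finset.mem_filter, Set.Finite.mem_toFinset] at hβ
    exact R.inner_pos_of_reflect_not_mem hφ hβ.1 hβ.2
  · simp only [Finset.mem_filter, Set.Finite.mem_toFinset]
    refine ⟨hφ, ?_⟩
    rw [mul_div_cancel_right₀ _ hφ0.ne', two_smul, sub_add_cancel_left]
    exact R.not_neg_mem φ hφ

lemma mem_pos_of_posSum {φ : V} (hφ : φ ∈ R.Δ) (h : 0 ≤ ⟪R.posSum, φ⟫_ℝ) : φ ∈ R.Pos := by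
  refine (R.mem_or_neg φ hφ).resolve_right fun hn => ?_
  have := R.posSum_pos hn
  rw [inner_neg_right] at this
  linarith

lemma pos_induction {P : V → Prop} (simple : ∀ α ∈ R.Simple, P α)
    (add : ∀ β ∈ R.Pos, ∀ γ ∈ R.Pos, β + γ ∈ R.Pos → P β → P γ → P (β + γ)) :
    ∀ φ ∈ R.Pos, P φ := by
  by_contra! hc
  obtain ⟨φ, ⟨hφ, hP⟩, hmin⟩ := Set.Finite.exists_minimalFor (fun φ => ⟪R.posSum, φ⟫_ℝ)
    {φ | φ ∈ R.Pos ∧ ¬ P φ} (R.finite.subset fun _ h => R.pos_subset h.1) hc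
  have hns : φ ∉ R.Simple := fun h => hP (simple φ h)
  have hdec : ∃ β ∈ R.Pos, ∃ γ ∈ R.Pos, φ = β + γ := by
    by_contra hd
    exact hns ⟨hφ, hd⟩
  obtain ⟨β, hβ, γ, hγ, rfl⟩ := hdec
  have h1 := R.posSum_pos hβ
  have h2 := R.posSum_pos hγ
  refine hP (add β hβ γ hγ hφ ?_ ?_)
  · by_contra hPβ
    have := hmin (j := β) ⟨hβ, hPβ⟩ (by simp only [inner_add_right]; linarith)
    simp only [inner_add_right] at this
    linarith
  · by_contra hPγ
    have := hmin (j := γ) ⟨hγ, hPγ⟩ (by simp only [inner_add_right]; linarith)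
    simp only [inner_add_right] at this
    linarith

end Roots

section Base

lemma inner_simple_nonpos_s3 {α β : V} (hα : α ∈ R.Simple) (hβ : β ∈ R.Simple) (hne : α ≠ β) :
    ⟪α, β⟫_ℝ ≤ 0 := by
  by_contra! hpos
  rcases R.add_mem_or_eq_zero (R.pos_subset hα.1) (R.neg_mem _ (R.pos_subset hβ.1))
    (by rw [inner_neg_right]; linarith) with h | h
  · rcases R.mem_or_neg _ h with h1 | h1
    · exact hα.2 ⟨β, hβ.1, _, h1, by abel⟩
    · exact hβ.2 ⟨α, hα.1, _, h1, by abel⟩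
  · exact hne (by rwa [add_neg_eq_zero] at h)

lemma linearIndependent_simple : LinearIndependent ℝ (fun α : R.Simple => (α : V)) := by
  refine LinearMap.BilinForm.linearIndependent_of_pairwise_le_zero (innerₗ V) ?_
    (innerₗ V R.posSum) _ ?_ ?_
  · intro x hx
    simpa using pow_pos (norm_pos_iff.2 hx) 2
  · intro α
    simpa using R.posSum_pos α.2.1
  · intro α β hne
    simpa using R.inner_simple_nonpos_s3 α.2 β.2 (fun h => hne (Subtype.ext h))

lemma span_simple : Submodule.span ℝ R.Simple = ⊤ := by
  have hpos : ∀ φ ∈ R.Pos, φ ∈ Submodule.span ℝ R.Simple :=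
    R.pos_induction (fun α hα => Submodule.subset_span hα)
      (fun β _ γ _ _ h1 h2 => Submodule.add_mem _ h1 h2)
  rw [← top_le_iff, ← R.span_top, Submodule.span_le]
  intro φ hφ
  rcases R.mem_or_neg φ hφ with h | h
  · exact hpos φ h
  · simpa using hpos _ h

/-- The simple roots as a basis of the ambient space. -/
noncomputable def base : Module.Basis R.Simple ℝ V :=
  Module.Basis.mk R.linearIndependent_simple (by simp [R.span_simple])

@[simp] lemma base_apply (α : R.Simple) : R.base α = α := by simp [base]

noncomputable instance : Fintype R.Simple :=
  (R.finite.subset fun _ h => R.pos_subset h.1).fintype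

lemma repr_simple_self (α : R.Simple) : R.base.repr (α : V) α = 1 := by
  rw [← R.base_apply α, R.base.repr_self]; simp

lemma repr_nonneg {φ : V} (hφ : φ ∈ R.Pos) : ∀ α, 0 ≤ R.base.repr φ α := by
  refine R.pos_induction (P := fun φ => ∀ α, 0 ≤ R.base.repr φ α) ?_ ?_ φ hφ
  · classical
    intro α hα γ
    have : R.base.repr α = Finsupp.single ⟨α, hα⟩ 1 := by
      rw [← R.base.repr_self, R.base_apply]
    rw [this, Finsupp.single_apply]
    split_ifs <;> norm_num
  · intro β _ γ _ _ h1 h2 α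
    rw [map_add, Finsupp.add_apply]
    exact add_nonneg (h1 α) (h2 α)

lemma mem_span_iff {K : Set V} (hK : K ⊆ R.Simple) (x : V) :
    x ∈ Submodule.span ℝ K ↔ ∀ α : R.Simple, (α : V) ∉ K → R.base.repr x α = 0 := by
  have himg : K = R.base '' {α | (α : V) ∈ K} := by
    ext v
    simp only [Set.mem_image, Set.mem_ofPred_eq, base_apply]
    exact ⟨fun h => ⟨⟨v, hK h⟩, h, rfl⟩, fun ⟨α, h, e⟩ => e ▸ h⟩
  conv_lhs => rw [himg]
  rw [R.base.mem_span_image]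
  constructor
  · intro h α hα
    by_contra hne
    exact hα (h (Finsupp.mem_support_iff.2 hne))
  · intro h α hα
    by_contra hne
    exact Finsupp.mem_support_iff.1 hα (h α hne)

lemma sum_repr_inner (x y : V) :
    ⟪x, y⟫_ℝ = ∑ α : R.Simple, R.base.repr x α * ⟪(α : V), y⟫_ℝ := by
  conv_lhs => rw [← R.base.sum_repr x, sum_inner]
  simp [real_inner_smul_left]

end Base

section NonnegComb

variable {R}

lemma NonnegComb.zero : R.NonnegComb 0 := ⟨0, by simp, by simp⟩

lemma NonnegComb.of_pos {φ : V} (hφ : φ ∈ R.Pos) : R.NonnegComb φ := by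
  refine ⟨Finsupp.single φ 1, ?_, by simp⟩
  intro x hx
  have := Finsupp.support_single_subset hx
  simp only [Finset.mem_singleton] at this
  exact this ▸ hφ

lemma NonnegComb.add {x y : V} (hx : R.NonnegComb x) (hy : R.NonnegComb y) :
    R.NonnegComb (x + y) := by
  classical
  obtain ⟨c, hc, rfl⟩ := hx
  obtain ⟨d, hd, rfl⟩ := hy
  refine ⟨c + d, ?_, ?_⟩
  · intro v hv
    rcases Finset.mem_union.1 (Finsupp.support_add hv) with h | h
    · exact hc h
    · exact hd h
  · rw [Finsupp.sum_add_index']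
    · simp
    · intro a m n
      push_cast
      rw [add_smul]

lemma NonnegComb.repr_nonneg {x : V} (hx : R.NonnegComb x) (α : R.Simple) :
    0 ≤ R.base.repr x α := by
  obtain ⟨c, hc, rfl⟩ := hx
  rw [Finsupp.sum, map_sum, Finsupp.finsetSum_apply]
  refine Finset.sum_nonneg fun φ hφ => ?_
  rw [map_smul, Finsupp.smul_apply, smul_eq_mul]
  exact mul_nonneg (Nat.cast_nonneg _) (R.repr_nonneg (hc hφ) α)

lemma NonnegComb.eq_zero_of_neg {x : V} (hx : R.NonnegComb x) (hx' : R.NonnegComb (-x)) :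
    x = 0 := by
  refine R.base.ext_elem fun α => ?_
  have h1 := hx.repr_nonneg α
  have h2 := hx'.repr_nonneg α
  rw [map_neg, Finsupp.neg_apply] at h2
  rw [map_zero, Finsupp.zero_apply]
  linarith

lemma IsHighest.unique {S : Set V} {β γ : V} (hβ : R.IsHighest S β) (hγ : R.IsHighest S γ) :
    β = γ :=
  sub_eq_zero.1 <| (hβ.2.2 γ hγ.1).eq_zero_of_neg (by simpa using hγ.2.2 β hβ.1)

end NonnegComb

end RootSystemData

lemma inner_eq_zero_of_mem_span {V : Type*} [NormedAddCommGroup V] [InnerProductSpace ℝ V]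
    {A : Set V} {v x : V} (h : ∀ a ∈ A, ⟪v, a⟫_ℝ = 0) (hx : x ∈ Submodule.span ℝ A) :
    ⟪v, x⟫_ℝ = 0 := by
  induction hx using Submodule.span_induction with
  | mem a ha => exact h a ha
  | zero => exact inner_zero_right _
  | add a b _ _ h1 h2 => rw [inner_add_right, h1, h2, add_zero]
  | smul t a _ h1 => rw [real_inner_smul_right, h1, mul_zero]

section Component

variable {V : Type*} [NormedAddCommGroup V] [InnerProductSpace ℝ V]

lemma exists_component {S : Set V} {φ : V} (hφ : φ ∈ S) : ∃ C, IsComponent S C ∧ φ ∈ C := by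
  let r : V → V → Prop := fun a b => b ∈ S ∧ ⟪a, b⟫_ℝ ≠ 0
  have hsub : ∀ x, Relation.ReflTransGen r φ x → x ∈ S := by
    intro x hx
    rcases Relation.ReflTransGen.cases_tail hx with rfl | ⟨_, _, h⟩
    · exact hφ
    · exact h.1
  have hreach : ∀ A B : Set V, A ∪ B = {x | Relation.ReflTransGen r φ x} → φ ∈ A →
      (∀ a ∈ A, ∀ b ∈ B, ⟪a, b⟫_ℝ = 0) → ∀ x, Relation.ReflTransGen r φ x → x ∈ A := by
    intro A B hAB hA horth x hx
    induction hx with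
    | refl => exact hA
    | tail hxy hr ih =>
      have hmem := (Set.ext_iff.1 hAB _).2 (hxy.tail hr)
      exact hmem.resolve_right fun hB => hr.2 (horth _ ih _ hB)
  refine ⟨{x | Relation.ReflTransGen r φ x}, ⟨hsub, ⟨⟨φ, .refl⟩, ?_⟩, ?_⟩, .refl⟩
  · rintro ⟨A, B, hAB, hdisj, ⟨a, ha⟩, ⟨b, hb⟩, horth⟩
    rcases (Set.ext_iff.1 hAB φ).2 .refl with h | h
    · exact (Set.ext_iff.1 hdisj b).1
        ⟨hreach A B hAB h horth b ((Set.ext_iff.1 hAB b).1 (Or.inr hb)), hb⟩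
    · refine (Set.ext_iff.1 hdisj a).1
        ⟨ha, hreach B A (by rwa [Set.union_comm]) h (fun x hx y hy => ?_) a
          ((Set.ext_iff.1 hAB a).1 (Or.inl ha))⟩
      rw [real_inner_comm]
      exact horth y hy x hx
  · intro a ha b hb
    by_contra hne
    exact hb.2 (Relation.ReflTransGen.tail ha ⟨hb.1, hne⟩)

lemma IsComponent.subset_of_mem {S C D : Set V} {φ : V} (hC : IsComponent S C)
    (hD : IsComponent S D) (hφC : φ ∈ C) (hφD : φ ∈ D) : C ⊆ D := by
  by_contra hnot
  obtain ⟨x, hx, hxD⟩ := Set.not_subset.1 hnot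
  refine hC.2.1.2 ⟨C ∩ D, C \ D, Set.inter_union_sdiff C D, ?_, ⟨φ, hφC, hφD⟩, ⟨x, hx, hxD⟩, ?_⟩
  · ext y; simp only [Set.mem_inter_iff, Set.mem_sdiff, Set.mem_empty_iff_false]; tauto
  · exact fun a ha b hb => hD.2.2 a ha.2 b ⟨hC.1 hb.1, hb.2⟩

lemma IsComponent.eq_of_mem {S C D : Set V} {φ : V} (hC : IsComponent S C)
    (hD : IsComponent S D) (hφC : φ ∈ C) (hφD : φ ∈ D) : C = D :=
  (hC.subset_of_mem hD hφC hφD).antisymm (hD.subset_of_mem hC hφD hφC)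

end Component

namespace RootSystemData

variable {V : Type*} [NormedAddCommGroup V] [InnerProductSpace ℝ V] (R : RootSystemData V)

section Levi

/-- The roots lying in the span of `K`. -/
def levi (K : Set V) : Set V := {ψ ∈ R.Δ | ψ ∈ Submodule.span ℝ K}

lemma sub_eq_levi (φ : V) : R.sub φ = R.levi (R.support φ) := rfl

lemma levi_simple : R.levi R.Simple = R.Δ := by
  ext φ
  simp [levi, R.span_simple]

variable {R}

lemma simple_mem_levi {K : Set V} (hK : K ⊆ R.Simple) {α : V} (hα : α ∈ K) : α ∈ R.levi K :=
  ⟨R.pos_subset (hK hα).1, Submodule.subset_span hα⟩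

lemma neg_mem_levi {K : Set V} {φ : V} (h : φ ∈ R.levi K) : -φ ∈ R.levi K :=
  ⟨R.neg_mem φ h.1, Submodule.neg_mem _ h.2⟩

lemma eq_levi_of_isComponent {K C : Set V} (hK : K ⊆ R.Simple) (hC : IsComponent (R.levi K) C) :
    C = R.levi (K ∩ C) := by
  have horth : ∀ φ ∈ C, ∀ y ∈ Submodule.span ℝ (K \ C), ⟪φ, y⟫_ℝ = 0 := fun φ hφ y hy =>
    inner_eq_zero_of_mem_span
      (fun a ha => hC.2.2 φ hφ a ⟨simple_mem_levi hK ha.1, ha.2⟩) hy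
  ext φ
  constructor
  · intro hφ
    refine ⟨(hC.1 hφ).1, ?_⟩
    have hmem := (hC.1 hφ).2
    rw [← Set.inter_union_sdiff K C, Submodule.span_union, Submodule.mem_sup] at hmem
    obtain ⟨x, hx, y, hy, rfl⟩ := hmem
    have h1 := horth _ hφ y hy
    have h2 : ⟪y, x⟫_ℝ = 0 := inner_eq_zero_of_mem_span
      (fun a ha => by rw [real_inner_comm]; exact horth a ha.2 y hy) hx
    rw [inner_add_left, real_inner_comm, h2, zero_add, inner_self_eq_zero] at h1
    rw [h1, add_zero]
    exact hx
  · rintro ⟨hφ, hspan⟩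
    by_contra hnot
    have hS : φ ∈ R.levi K := ⟨hφ, Submodule.span_mono Set.inter_subset_left hspan⟩
    refine R.ne_zero hφ ((inner_self_eq_zero (𝕜 := ℝ)).1 ?_)
    refine inner_eq_zero_of_mem_span (fun a ha => ?_) hspan
    rw [real_inner_comm]
    exact hC.2.2 a ha.2 φ ⟨hS, hnot⟩

lemma IsHighest.support_eq {K : Set V} {β : V} (hK : K ⊆ R.Simple)
    (hβ : R.IsHighest (R.levi K) β) : R.support β = K := by
  ext α
  constructor
  · rintro ⟨hα, hnot⟩
    by_contra hαK
    exact hnot (Submodule.span_mono (Set.subset_sdiff_singleton hK hαK) hβ.1.2)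
  · intro hα
    refine ⟨hK hα, fun hspan => ?_⟩
    have h1 := (R.mem_span_iff Set.sdiff_subset β).1 hspan ⟨α, hK hα⟩ (by simp)
    have h2 := (hβ.2.2 α (simple_mem_levi hK hα)).repr_nonneg ⟨α, hK hα⟩
    have h3 := R.repr_simple_self ⟨α, hK hα⟩
    rw [map_sub, Finsupp.sub_apply, h1] at h2
    simp only at h3
    linarith

lemma IsHighest.inner_simple_nonneg {K : Set V} {β : V} (hK : K ⊆ R.Simple)
    (hβ : R.IsHighest (R.levi K) β) {α : V} (hα : α ∈ K) : 0 ≤ ⟪α, β⟫_ℝ := by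
  by_contra! hneg
  have hsum := R.add_mem_pos (hK hα).1 hβ.2.1 hneg
  have h := (hβ.2.2 _ ⟨R.pos_subset hsum,
    Submodule.add_mem _ (Submodule.subset_span hα) hβ.1.2⟩).repr_nonneg ⟨α, hK hα⟩
  have h3 := R.repr_simple_self ⟨α, hK hα⟩
  rw [show β - (α + β) = -α by abel, map_neg, Finsupp.neg_apply] at h
  simp only at h3
  linarith

lemma repr_mul_inner_nonneg {K : Set V} (hK : K ⊆ R.Simple) {x : V}
    (hx : x ∈ Submodule.span ℝ K) {y : V} (hx0 : ∀ α, 0 ≤ R.base.repr x α)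
    (hy : ∀ α ∈ K, 0 ≤ ⟪α, y⟫_ℝ) (α : R.Simple) : 0 ≤ R.base.repr x α * ⟪(α : V), y⟫_ℝ := by
  by_cases hα : (α : V) ∈ K
  · exact mul_nonneg (hx0 α) (hy α hα)
  · rw [(R.mem_span_iff hK x).1 hx α hα, zero_mul]

lemma inner_nonneg_of_mem_span {K : Set V} (hK : K ⊆ R.Simple) {x : V}
    (hx : x ∈ Submodule.span ℝ K) {y : V} (hx0 : ∀ α, 0 ≤ R.base.repr x α)
    (hy : ∀ α ∈ K, 0 ≤ ⟪α, y⟫_ℝ) : 0 ≤ ⟪x, y⟫_ℝ := by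
  rw [R.sum_repr_inner]
  exact Finset.sum_nonneg fun α _ => repr_mul_inner_nonneg hK hx hx0 hy α

lemma inner_simple_eq_zero {K : Set V} (hK : K ⊆ R.Simple) {x : V}
    (hx : x ∈ Submodule.span ℝ K) {y : V} (hx0 : ∀ α, 0 ≤ R.base.repr x α)
    (hy : ∀ α ∈ K, 0 ≤ ⟪α, y⟫_ℝ) (hxy : ⟪x, y⟫_ℝ = 0) (α : R.Simple)
    (hα : R.base.repr x α ≠ 0) : ⟪(α : V), y⟫_ℝ = 0 := by
  rw [R.sum_repr_inner, Finset.sum_eq_zero_iff_of_nonneg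
    fun α _ => repr_mul_inner_nonneg hK hx hx0 hy α] at hxy
  exact (mul_eq_zero.1 (hxy α (Finset.mem_univ α))).resolve_left hα

lemma IsHighest.orth_eq {K : Set V} {β : V} (hK : K ⊆ R.Simple)
    (hβ : R.IsHighest (R.levi K) β) : R.orth β = R.levi {α ∈ K | ⟪α, β⟫_ℝ = 0} := by
  have hsub : R.sub β = R.levi K := by rw [R.sub_eq_levi, hβ.support_eq hK]
  have hpos : ∀ φ ∈ R.Pos, φ ∈ R.levi K → ⟪φ, β⟫_ℝ = 0 →
      φ ∈ Submodule.span ℝ {α ∈ K | ⟪α, β⟫_ℝ = 0} := by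
    intro φ hφ hφK h0
    rw [R.mem_span_iff fun α hα => hK hα.1]
    intro α hα
    by_contra hne
    refine hα ⟨?_, inner_simple_eq_zero hK hφK.2 (R.repr_nonneg hφ)
      (fun γ hγ => hβ.inner_simple_nonneg hK hγ) h0 α hne⟩
    by_contra hαK
    exact hne ((R.mem_span_iff hK φ).1 hφK.2 α hαK)
  ext φ
  rw [orth, hsub]
  constructor
  · rintro ⟨hφK, h0⟩
    refine ⟨hφK.1, ?_⟩
    rcases R.mem_or_neg φ hφK.1 with h | h
    · exact hpos φ h hφK h0
    · have := hpos _ h (neg_mem_levi hφK) (by rw [inner_neg_left, h0, neg_zero])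
      simpa using this
  · rintro ⟨hφ, hspan⟩
    refine ⟨⟨hφ, Submodule.span_mono (fun α hα => hα.1) hspan⟩, ?_⟩
    rw [real_inner_comm]
    exact inner_eq_zero_of_mem_span (fun α hα => by rw [real_inner_comm]; exact hα.2) hspan

end Levi

section HighestRoot

variable {R}

lemma eq_zero_of_sub_pos {K₁ K₂ : Set V} (h₁ : K₁ ⊆ R.Simple) (h₂ : K₂ ⊆ R.Simple)
    (hdisj : Disjoint K₁ K₂) {β γ : V} (hβ : β ∈ Submodule.span ℝ K₁)
    (hγ : γ ∈ Submodule.span ℝ K₂) (hγpos : γ ∈ R.Pos) : β - γ ∉ R.Pos := by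
  intro h
  refine R.ne_zero (R.pos_subset hγpos) (R.base.ext_elem fun α => ?_)
  rw [map_zero, Finsupp.zero_apply]
  by_cases hα : (α : V) ∈ K₂
  · have h1 := (R.mem_span_iff h₁ β).1 hβ α fun hα1 => Set.disjoint_left.1 hdisj hα1 hα
    have h2 := R.repr_nonneg h α
    have h3 := R.repr_nonneg hγpos α
    rw [map_sub, Finsupp.sub_apply, h1] at h2
    linarith
  · exact (R.mem_span_iff h₂ γ).1 hγ α hα

lemma add_not_mem_of_orthogonal {K₁ K₂ : Set V} (h₁ : K₁ ⊆ R.Simple) (h₂ : K₂ ⊆ R.Simple)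
    (hdisj : Disjoint K₁ K₂) (horth : ∀ a ∈ K₁, ∀ b ∈ K₂, ⟪a, b⟫_ℝ = 0) {β γ : V}
    (hβ : β ∈ Submodule.span ℝ K₁) (hγ : γ ∈ Submodule.span ℝ K₂) (hβpos : β ∈ R.Pos)
    (hγpos : γ ∈ R.Pos) : β + γ ∉ R.Δ := by
  intro hsum
  have h0 : ⟪β, γ⟫_ℝ = 0 := inner_eq_zero_of_mem_span (fun b hb => by
    rw [real_inner_comm]
    exact inner_eq_zero_of_mem_span
      (fun a ha => by rw [real_inner_comm]; exact horth a ha b hb) hβ) hγ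
  have hγ0 : ⟪γ, γ⟫_ℝ ≠ 0 := (real_inner_self_pos.2 (R.ne_zero (R.pos_subset hγpos))).ne'
  have hr := R.reflect_mem _ hsum γ (R.pos_subset hγpos)
  rw [inner_add_left, h0, zero_add, mul_div_cancel_right₀ _ hγ0, two_smul,
    show β + γ - (γ + γ) = β - γ by abel] at hr
  rcases R.mem_or_neg _ hr with h | h
  · exact eq_zero_of_sub_pos h₁ h₂ hdisj hβ hγ hγpos h
  · rw [neg_sub] at h
    exact eq_zero_of_sub_pos h₂ h₁ hdisj.symm hγ hβ hβpos h

lemma mem_span_or_of_orthogonal {K₁ K₂ : Set V} (h₁ : K₁ ⊆ R.Simple) (h₂ : K₂ ⊆ R.Simple)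
    (hdisj : Disjoint K₁ K₂) (horth : ∀ a ∈ K₁, ∀ b ∈ K₂, ⟪a, b⟫_ℝ = 0) {φ : V}
    (hφ : φ ∈ R.levi (K₁ ∪ K₂)) :
    φ ∈ Submodule.span ℝ K₁ ∨ φ ∈ Submodule.span ℝ K₂ := by
  have hK : K₁ ∪ K₂ ⊆ R.Simple := Set.union_subset h₁ h₂
  have hpos : ∀ φ ∈ R.Pos, φ ∈ Submodule.span ℝ (K₁ ∪ K₂) →
      φ ∈ Submodule.span ℝ K₁ ∨ φ ∈ Submodule.span ℝ K₂ := by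
    refine R.pos_induction ?_ ?_
    · intro α hα hspan
      by_cases hαK : α ∈ K₁ ∪ K₂
      · exact hαK.imp (fun h => Submodule.subset_span h) (fun h => Submodule.subset_span h)
      · have := (R.mem_span_iff hK α).1 hspan ⟨α, hα⟩ hαK
        rw [show R.base.repr α ⟨α, hα⟩ = 1 from R.repr_simple_self ⟨α, hα⟩] at this
        exact absurd this one_ne_zero
    · intro β hβ γ hγ hsum ihβ ihγ hspan
      have hcoord : ∀ α : R.Simple, (α : V) ∉ K₁ ∪ K₂ →
          R.base.repr β α = 0 ∧ R.base.repr γ α = 0 := by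
        intro α hα
        have h := (R.mem_span_iff hK _).1 hspan α hα
        rw [map_add, Finsupp.add_apply] at h
        have h1 := R.repr_nonneg hβ α
        have h2 := R.repr_nonneg hγ α
        constructor <;> linarith
      have hβK := ihβ ((R.mem_span_iff hK β).2 fun α hα => (hcoord α hα).1)
      have hγK := ihγ ((R.mem_span_iff hK γ).2 fun α hα => (hcoord α hα).2)
      rcases hβK with hβ1 | hβ2 <;> rcases hγK with hγ1 | hγ2
      · exact Or.inl (Submodule.add_mem _ hβ1 hγ1)
      · exact absurd (R.pos_subset hsum)
          (add_not_mem_of_orthogonal h₁ h₂ hdisj horth hβ1 hγ2 hβ hγ)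
      · rw [add_comm] at hsum
        exact absurd (R.pos_subset hsum)
          (add_not_mem_of_orthogonal h₁ h₂ hdisj horth hγ1 hβ2 hγ hβ)
      · exact Or.inr (Submodule.add_mem _ hβ2 hγ2)
  rcases R.mem_or_neg φ hφ.1 with h | h
  · exact hpos φ h hφ.2
  · simpa using hpos _ h (Submodule.neg_mem _ hφ.2)

lemma not_isIrred_levi_union {K₁ K₂ : Set V} (h₁ : K₁ ⊆ R.Simple) (h₂ : K₂ ⊆ R.Simple)
    (hdisj : Disjoint K₁ K₂) (horth : ∀ a ∈ K₁, ∀ b ∈ K₂, ⟪a, b⟫_ℝ = 0)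
    (hne₁ : K₁.Nonempty) (hne₂ : K₂.Nonempty) : ¬ IsIrred (R.levi (K₁ ∪ K₂)) := by
  have hspan : ∀ a ∈ Submodule.span ℝ K₁, ∀ b ∈ Submodule.span ℝ K₂, ⟪a, b⟫_ℝ = 0 :=
    fun a ha b hb => inner_eq_zero_of_mem_span (fun y hy => by
      rw [real_inner_comm]
      exact inner_eq_zero_of_mem_span
        (fun x hx => by rw [real_inner_comm]; exact horth x hx y hy) ha) hb
  rintro ⟨-, hirr⟩
  refine hirr ⟨R.levi K₁, R.levi K₂, ?_, ?_, ?_, ?_, fun a ha b hb => hspan a ha.2 b hb.2⟩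
  · ext φ
    constructor
    · rintro (h | h)
      · exact ⟨h.1, Submodule.span_mono Set.subset_union_left h.2⟩
      · exact ⟨h.1, Submodule.span_mono Set.subset_union_right h.2⟩
    · intro h
      exact (mem_span_or_of_orthogonal h₁ h₂ hdisj horth h).imp (fun h' => ⟨h.1, h'⟩)
        (fun h' => ⟨h.1, h'⟩)
  · refine Set.eq_empty_iff_forall_notMem.2 fun φ hφ => R.ne_zero hφ.1.1 ?_
    exact (inner_self_eq_zero (𝕜 := ℝ)).1 (hspan φ hφ.1.2 φ hφ.2.2)
  · exact hne₁.mono fun α hα => simple_mem_levi h₁ hα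
  · exact hne₂.mono fun α hα => simple_mem_levi h₂ hα

lemma exists_isHighest {K : Set V} (hK : K ⊆ R.Simple) (hirr : IsIrred (R.levi K)) :
    ∃ β, R.IsHighest (R.levi K) β := by
  have hfin : (R.levi K).Finite := R.finite.subset fun _ h => h.1
  obtain ⟨β, hβ, hmax⟩ := Set.Finite.exists_maximalFor (fun φ => ⟪R.posSum, φ⟫_ℝ) _ hfin hirr.1
  replace hmax : ∀ ψ ∈ R.levi K, ⟪R.posSum, ψ⟫_ℝ ≤ ⟪R.posSum, β⟫_ℝ := fun ψ hψ => by
    by_contra! hlt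
    exact absurd (hmax hψ hlt.le) (not_le.2 hlt)
  have hβpos : β ∈ R.Pos := by
    refine R.mem_pos_of_posSum hβ.1 ?_
    have := hmax _ (neg_mem_levi hβ)
    rw [inner_neg_right] at this
    linarith
  have hdom : ∀ α ∈ K, 0 ≤ ⟪α, β⟫_ℝ := by
    intro α hα
    by_contra! hneg
    have hsum := R.add_mem_pos (hK hα).1 hβpos hneg
    have h1 := hmax _ ⟨R.pos_subset hsum, Submodule.add_mem _ (Submodule.subset_span hα) hβ.2⟩
    have h2 := R.posSum_pos (hK hα).1
    rw [inner_add_right] at h1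
    linarith
  have hfull : ∀ α : R.Simple, (α : V) ∈ K → 0 < R.base.repr β α := by
    by_contra! hc
    obtain ⟨α₀, hα₀, hle⟩ := hc
    set K₁ : Set V := {v | ∃ α : R.Simple, v = α ∧ v ∈ K ∧ 0 < R.base.repr β α} with hK₁
    have hunion : K₁ ∪ (K \ K₁) = K := Set.union_sdiff_cancel fun v hv => hv.choose_spec.2.1
    have hcoord : ∀ α : R.Simple, (α : V) ∉ K₁ → R.base.repr β α = 0 := by
      intro α hα
      by_cases hαK : (α : V) ∈ K
      · refine le_antisymm ?_ (R.repr_nonneg hβpos α)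
        by_contra! hlt
        exact hα ⟨α, rfl, hαK, hlt⟩
      · exact (R.mem_span_iff hK β).1 hβ.2 α hαK
    have hK₁K : K₁ ⊆ R.Simple := fun v hv => hK hv.choose_spec.2.1
    refine not_isIrred_levi_union (R := R) (K₁ := K₁) (K₂ := K \ K₁) hK₁K
      (fun v hv => hK hv.1) Set.disjoint_sdiff_right ?_ ?_ ?_ (by rwa [hunion])
    · rintro a ⟨a', rfl, haK, ha⟩ b ⟨hbK, hb⟩
      have hspan : β ∈ Submodule.span ℝ K₁ := (R.mem_span_iff hK₁K β).2 hcoord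
      have hobt : ∀ γ ∈ K₁, 0 ≤ ⟪γ, -b⟫_ℝ := by
        intro γ hγ
        have := R.inner_simple_nonpos_s3 (hK₁K hγ) (hK hbK) (fun h => hb (h ▸ hγ))
        rw [inner_neg_right]
        linarith
      have h1 := inner_nonneg_of_mem_span hK₁K hspan (R.repr_nonneg hβpos) hobt
      have h2 := hdom b hbK
      rw [real_inner_comm] at h2
      rw [inner_neg_right] at h1
      have h3 := inner_simple_eq_zero hK₁K hspan (R.repr_nonneg hβpos) hobt
        (by rw [inner_neg_right]; linarith) a' ha.ne'
      rwa [inner_neg_right, neg_eq_zero] at h3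
    · by_contra hemp
      rw [Set.not_nonempty_iff_eq_empty] at hemp
      refine R.ne_zero hβ.1 (R.base.ext_elem fun α => ?_)
      rw [hcoord α (by simp [hemp]), map_zero, Finsupp.zero_apply]
    · refine ⟨α₀, hα₀, ?_⟩
      rintro ⟨α', he, -, hlt⟩
      rw [← Subtype.ext he] at hlt
      linarith
  refine ⟨β, hβ, hβpos, ?_⟩
  by_contra! hc
  obtain ⟨ψ, ⟨hψ, hnot⟩, hψmax⟩ := Set.Finite.exists_maximalFor (fun φ => ⟪R.posSum, φ⟫_ℝ)
    {ψ | ψ ∈ R.levi K ∧ ¬ R.NonnegComb (β - ψ)} (hfin.subset fun _ h => h.1) hc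
  have hψdom : ∀ α ∈ K, 0 ≤ ⟪α, ψ⟫_ℝ := by
    intro α hα
    by_contra! hneg
    have hα' := simple_mem_levi hK hα
    rcases R.add_mem_or_eq_zero hα'.1 hψ.1 hneg with hsum | hsum
    · have hmem : α + ψ ∈ R.levi K := ⟨hsum, Submodule.add_mem _ hα'.2 hψ.2⟩
      have hlt := R.posSum_pos (hK hα).1
      by_cases hcomb : R.NonnegComb (β - (α + ψ))
      · refine hnot ?_
        have := hcomb.add (NonnegComb.of_pos (hK hα).1)
        rwa [show β - (α + ψ) + α = β - ψ by abel] at this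
      · have := hψmax (j := α + ψ) ⟨hmem, hcomb⟩ (by simp only [inner_add_right]; linarith)
        simp only [inner_add_right] at this
        linarith
    · refine hnot ?_
      rw [← neg_eq_of_add_eq_zero_right hsum, sub_neg_eq_add]
      exact (NonnegComb.of_pos hβpos).add (NonnegComb.of_pos (hK hα).1)
  have hinner : 0 < ⟪β, ψ⟫_ℝ := by
    refine lt_of_le_of_ne
      (inner_nonneg_of_mem_span hK hβ.2 (R.repr_nonneg hβpos) hψdom) fun h0 => ?_
    refine R.ne_zero hψ.1 ((inner_self_eq_zero (𝕜 := ℝ)).1 ?_)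
    refine inner_eq_zero_of_mem_span (fun α hα => ?_) hψ.2
    rw [real_inner_comm]
    exact inner_simple_eq_zero hK hβ.2 (R.repr_nonneg hβpos) hψdom h0.symm ⟨α, hK hα⟩
      (hfull ⟨α, hK hα⟩ hα).ne'
  rcases R.add_mem_or_eq_zero hβ.1 (R.neg_mem _ hψ.1)
    (by rw [inner_neg_right]; linarith) with h | h
  · rw [← sub_eq_add_neg] at h
    refine hnot (NonnegComb.of_pos (R.mem_pos_of_posSum h ?_))
    rw [inner_sub_right]
    linarith [hmax ψ hψ]
  · rw [← sub_eq_add_neg] at h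
    exact hnot (h ▸ NonnegComb.zero)

end HighestRoot

section Cascade

/-- `b` is the highest root of an irreducible component of `S`. -/
def IsTop (S : Set V) (b : V) : Prop := ∃ C, IsComponent S C ∧ R.IsHighest C b

variable {R}

lemma IsTop.exists_levi {K : Set V} {b : V} (hK : K ⊆ R.Simple) (h : R.IsTop (R.levi K) b) :
    IsComponent (R.levi K) (R.sub b) ∧
      ∃ L ⊆ R.Simple, R.sub b = R.levi L ∧ R.IsHighest (R.levi L) b := by
  obtain ⟨C, hC, hb⟩ := h
  have hL : K ∩ C ⊆ R.Simple := fun _ hα => hK hα.1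
  have hCL := eq_levi_of_isComponent hK hC
  rw [hCL] at hb
  have hsub : R.sub b = R.levi (K ∩ C) := by rw [R.sub_eq_levi, hb.support_eq hL]
  refine ⟨?_, _, hL, hsub, hb⟩
  rw [hsub, ← hCL]
  exact hC

lemma IsTop.isHighest_sub {K : Set V} {b : V} (hK : K ⊆ R.Simple)
    (h : R.IsTop (R.levi K) b) : R.IsHighest (R.sub b) b := by
  obtain ⟨-, L, -, hsub, hb⟩ := h.exists_levi hK
  rwa [hsub]

lemma IsTop.orth_eq {K : Set V} {b : V} (hK : K ⊆ R.Simple) (h : R.IsTop (R.levi K) b) :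
    ∃ L ⊆ R.Simple, R.orth b = R.levi L := by
  obtain ⟨-, L, hL, -, hb⟩ := h.exists_levi hK
  exact ⟨_, fun α hα => hL hα.1, hb.orth_eq hL⟩

lemma IsTop.inner_nonneg {K : Set V} {b : V} (hK : K ⊆ R.Simple) (h : R.IsTop (R.levi K) b)
    {φ : V} (hφ : φ ∈ R.Pos) (hφb : φ ∈ R.sub b) : 0 ≤ ⟪φ, b⟫_ℝ := by
  obtain ⟨-, L, hL, hsub, hb⟩ := h.exists_levi hK
  rw [hsub] at hφb
  exact inner_nonneg_of_mem_span hL hφb.2 (R.repr_nonneg hφ)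
    fun α hα => hb.inner_simple_nonneg hL hα

lemma exists_isTop {K : Set V} (hK : K ⊆ R.Simple) {φ : V} (hφ : φ ∈ R.levi K) :
    ∃ b, R.IsTop (R.levi K) b ∧ φ ∈ R.sub b := by
  obtain ⟨C, hC, hφC⟩ := exists_component hφ
  have hCL := eq_levi_of_isComponent hK hC
  have hirr := hC.2.1
  rw [hCL] at hirr
  obtain ⟨b, hb⟩ := exists_isHighest (fun _ hα => hK hα.1) hirr
  refine ⟨b, ⟨C, hC, hCL ▸ hb⟩, ?_⟩
  rw [R.sub_eq_levi, hb.support_eq fun _ hα => hK hα.1, ← hCL]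
  exact hφC

lemma IsTop.eq_of_mem {K : Set V} {b c φ : V} (hK : K ⊆ R.Simple) (hb : R.IsTop (R.levi K) b)
    (hc : R.IsTop (R.levi K) c) (hφb : φ ∈ R.sub b) (hφc : φ ∈ R.sub c) : b = c := by
  have hsub := (hb.exists_levi hK).1.eq_of_mem (hc.exists_levi hK).1 hφb hφc
  refine (hb.isHighest_sub hK).unique ?_
  rw [hsub]
  exact hc.isHighest_sub hK

lemma sub_subset_orth_of_isChain (t : List V) : ∀ (b : V) (K : Set V), K ⊆ R.Simple →
    R.IsTop (R.levi K) b → List.IsChain (fun γ δ => R.IsTop (R.orth γ) δ) (b :: t) →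
    ∀ x ∈ t, R.sub x ⊆ R.orth b := by
  induction t with
  | nil => simp
  | cons c t ih =>
    intro b K hK hb hchain x hx
    rw [List.isChain_cons_cons] at hchain
    obtain ⟨L, hL, horth⟩ := hb.orth_eq hK
    have hc := hchain.1
    rw [horth] at hc ⊢
    have hsub : R.sub c ⊆ R.levi L := (hc.exists_levi hL).1.1
    rcases List.mem_cons.1 hx with rfl | hx
    · exact hsub
    · exact (ih c L hL hc hchain.2 x hx).trans fun y hy => hsub hy.1

lemma eq_of_isChain (t : List V) : ∀ (b : V) (t' : List V) (b' : V) (K : Set V) (φ : V),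
    K ⊆ R.Simple → R.IsTop (R.levi K) b → R.IsTop (R.levi K) b' →
    List.IsChain (fun γ δ => R.IsTop (R.orth γ) δ) (b :: t) →
    List.IsChain (fun γ δ => R.IsTop (R.orth γ) δ) (b' :: t') →
    φ ∈ R.E ((b :: t).getLast (List.cons_ne_nil b t)) →
    φ ∈ R.E ((b' :: t').getLast (List.cons_ne_nil b' t')) → b :: t = b' :: t' := by
  have hmem : ∀ (s : List V) (b : V) (K : Set V) (φ : V), K ⊆ R.Simple → R.IsTop (R.levi K) b →
      List.IsChain (fun γ δ => R.IsTop (R.orth γ) δ) (b :: s) →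
      φ ∈ R.E ((b :: s).getLast (List.cons_ne_nil b s)) →
      φ ∈ R.sub b ∧ (s ≠ [] → ⟪φ, b⟫_ℝ = 0) := by
    intro s b K φ hK hb hchain hφ
    cases s with
    | nil => exact ⟨hφ.1, fun h => absurd rfl h⟩
    | cons c s =>
      rw [List.getLast_cons_cons] at hφ
      have := sub_subset_orth_of_isChain _ b K hK hb hchain _
        (List.getLast_mem (List.cons_ne_nil c s)) hφ.1
      exact ⟨this.1, fun _ => this.2⟩
  induction t with
  | nil =>
    intro b t' b' K φ hK hb hb' h h' hφ hφ'
    have h1 := hmem _ b K φ hK hb h hφ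
    have h2 := hmem _ b' K φ hK hb' h' hφ'
    obtain rfl := hb.eq_of_mem hK hb' h1.1 h2.1
    cases t' with
    | nil => rfl
    | cons c' t' => exact absurd (h2.2 (List.cons_ne_nil _ _)) hφ.2.ne'
  | cons c t ih =>
    intro b t' b' K φ hK hb hb' h h' hφ hφ'
    have h1 := hmem _ b K φ hK hb h hφ
    have h2 := hmem _ b' K φ hK hb' h' hφ'
    obtain rfl := hb.eq_of_mem hK hb' h1.1 h2.1
    cases t' with
    | nil => exact absurd (h1.2 (List.cons_ne_nil _ _)) hφ'.2.ne'
    | cons c' t' =>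
      obtain ⟨L, hL, horth⟩ := hb.orth_eq hK
      rw [List.isChain_cons_cons, horth] at h h'
      rw [List.getLast_cons_cons] at hφ hφ'
      rw [ih c t' c' L φ hL h.1 h'.1 h.2 h'.2 hφ hφ']

lemma isChainCascade_cons {b : V} {t : List V} : R.IsChainCascade (b :: t) ↔
    R.IsTop R.Δ b ∧ List.IsChain (fun γ δ => R.IsTop (R.orth γ) δ) (b :: t) := by
  refine ⟨fun h => ⟨h.2.1 b rfl, h.2.2⟩, fun h => ⟨List.cons_ne_nil _ _, ?_, h.2⟩⟩
  rintro c hc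
  obtain rfl : b = c := by simpa using hc
  exact h.1

lemma IsChainCascade.eq_of_mem_E {l l' : List V} {β β' φ : V} (h : R.IsChainCascade l)
    (h' : R.IsChainCascade l') (hl : l.getLast? = some β) (hl' : l'.getLast? = some β')
    (hφ : φ ∈ R.E β) (hφ' : φ ∈ R.E β') : l = l' := by
  cases l with
  | nil => simp at hl
  | cons b t =>
    cases l' with
    | nil => simp at hl'
    | cons b' t' =>
      rw [isChainCascade_cons, ← R.levi_simple] at h h'
      rw [List.getLast?_eq_some_getLast (List.cons_ne_nil _ _), Option.some_inj] at hl hl'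
      exact eq_of_isChain t b t' b' R.Simple φ subset_rfl h.1 h'.1 h.2 h'.2
        (by rwa [hl]) (by rwa [hl'])

lemma exists_isChainCascade_getLast {β : V} (hβ : β ∈ R.cascade) :
    ∃ l, R.IsChainCascade l ∧ l.getLast? = some β := by
  obtain ⟨l, hl, hmem⟩ := hβ
  obtain ⟨l₁, l₂, rfl⟩ := List.append_of_mem hmem
  refine ⟨l₁ ++ [β], ⟨by simp, fun b hb => hl.2.1 b ?_, ?_⟩, by simp⟩
  · cases l₁ <;> simpa using hb
  · exact (List.isChain_split.1 hl.2.2).1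

lemma mem_cascade_of_isTop {β : V} (h : R.IsTop R.Δ β) : β ∈ R.cascade :=
  ⟨[β], isChainCascade_cons.2 ⟨h, List.isChain_singleton β⟩, by simp⟩

lemma mem_cascade_of_isTop_orth {β γ : V} (hβ : β ∈ R.cascade) (h : R.IsTop (R.orth β) γ) :
    γ ∈ R.cascade := by
  obtain ⟨l, hl, hlast⟩ := exists_isChainCascade_getLast hβ
  cases l with
  | nil => simp at hlast
  | cons b t =>
    refine ⟨b :: (t ++ [γ]), ?_, by simp⟩
    rw [isChainCascade_cons] at hl ⊢
    refine ⟨hl.1, ?_⟩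
    rw [← List.cons_append, List.isChain_append]
    refine ⟨hl.2, List.isChain_singleton γ, fun x hx y hy => ?_⟩
    rw [hlast] at hx
    obtain rfl : β = x := by simpa using hx
    obtain rfl : γ = y := by simpa using hy
    exact h

lemma exists_isTop_of_isChain (t : List V) : ∀ (b : V) (K : Set V), K ⊆ R.Simple →
    R.IsTop (R.levi K) b → List.IsChain (fun γ δ => R.IsTop (R.orth γ) δ) (b :: t) →
    ∀ x ∈ b :: t, ∃ L ⊆ R.Simple, R.IsTop (R.levi L) x := by
  induction t with
  | nil =>
    intro b K hK hb _ x hx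
    obtain rfl : x = b := by simpa using hx
    exact ⟨K, hK, hb⟩
  | cons c t ih =>
    intro b K hK hb hchain x hx
    rcases List.mem_cons.1 hx with rfl | hx
    · exact ⟨K, hK, hb⟩
    · obtain ⟨L, hL, horth⟩ := hb.orth_eq hK
      rw [List.isChain_cons_cons, horth] at hchain
      exact ih c L hL hchain.1 hchain.2 x hx

lemma exists_isTop_of_mem_cascade {β : V} (hβ : β ∈ R.cascade) :
    ∃ K ⊆ R.Simple, R.IsTop (R.levi K) β := by
  obtain ⟨l, hl, hmem⟩ := hβ
  cases l with
  | nil => simp at hmem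
  | cons b t =>
    rw [isChainCascade_cons, ← R.levi_simple] at hl
    exact exists_isTop_of_isChain t b _ subset_rfl hl.1 hl.2 β hmem

lemma E_subset_pos {β : V} (hβ : β ∈ R.cascade) : R.E β ⊆ R.Pos := by
  intro φ hφ
  obtain ⟨K, hK, htop⟩ := exists_isTop_of_mem_cascade hβ
  refine (R.mem_or_neg φ hφ.1.1).resolve_right fun hneg => ?_
  have := htop.inner_nonneg hK hneg (neg_mem_levi hφ.1)
  rw [inner_neg_left] at this
  linarith [hφ.2]

lemma exists_mem_E {φ : V} (hφ : φ ∈ R.Pos) : ∃ β ∈ R.cascade, φ ∈ R.E β := by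
  have hne : {β | β ∈ R.cascade ∧ φ ∈ R.sub β}.Nonempty := by
    obtain ⟨b, hb, hφb⟩ := exists_isTop (R := R) (K := R.Simple) subset_rfl
      (by rw [R.levi_simple]; exact R.pos_subset hφ)
    rw [R.levi_simple] at hb
    exact ⟨b, mem_cascade_of_isTop hb, hφb⟩
  obtain ⟨β, ⟨hβ, hφβ⟩, hmin⟩ := exists_minimalFor_of_wellFoundedLT
    (· ∈ {β | β ∈ R.cascade ∧ φ ∈ R.sub β}) (fun β => (R.sub β).ncard) hne
  refine ⟨β, hβ, hφβ, ?_⟩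
  obtain ⟨K, hK, htop⟩ := exists_isTop_of_mem_cascade hβ
  refine lt_of_le_of_ne (htop.inner_nonneg hK hφ hφβ) fun h0 => ?_
  obtain ⟨L, hL, horth⟩ := htop.orth_eq hK
  have hφo : φ ∈ R.orth β := ⟨hφβ, h0.symm⟩
  rw [horth] at hφo
  obtain ⟨γ, hγ, hφγ⟩ := exists_isTop hL hφo
  have hsub : R.sub γ ⊆ R.orth β := horth ▸ (hγ.exists_levi hL).1.1
  have hββ : β ∈ R.sub β := (htop.isHighest_sub hK).1
  have hlt : (R.sub γ).ncard < (R.sub β).ncard := by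
    refine Set.ncard_lt_ncard ⟨fun x hx => (hsub hx).1, fun hle => ?_⟩
      (R.finite.subset fun _ h => h.1)
    exact R.ne_zero hββ.1 (inner_self_eq_zero.1 (hsub (hle hββ)).2)
  exact absurd (hmin ⟨mem_cascade_of_isTop_orth hβ (horth ▸ hγ), hφγ⟩ hlt.le) (not_le.2 hlt)

lemma IsCascadeChainOf.exists_getLast {φ : V} {l : List V} (h : R.IsCascadeChainOf φ l) :
    ∃ β ∈ R.cascade, l.getLast? = some β ∧ φ ∈ R.E β := by
  obtain ⟨β, hβ⟩ := Option.ne_none_iff_exists'.1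
    (fun hn => h.1.1 (List.getLast?_eq_none_iff.1 hn) : l.getLast? ≠ none)
  have hmem : β ∈ l := List.mem_of_getLast? hβ
  exact ⟨β, ⟨l, h.1, hmem⟩, hβ, h.2.1 β hmem, h.2.2.2 β hβ⟩

lemma eq_of_mem_E {β β' φ : V} (hβ : β ∈ R.cascade) (hβ' : β' ∈ R.cascade) (hφ : φ ∈ R.E β)
    (hφ' : φ ∈ R.E β') : β = β' := by
  obtain ⟨l, hl, hlast⟩ := exists_isChainCascade_getLast hβ
  obtain ⟨l', hl', hlast'⟩ := exists_isChainCascade_getLast hβ'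
  obtain rfl := hl.eq_of_mem_E hl' hlast hlast' hφ hφ'
  exact Option.some_injective _ (hlast.symm.trans hlast')

end Cascade

end RootSystemData

/-- For positive roots `φ, φ′` one has `C(φ) = C(φ′)` iff there is `β ∈ ℬ`
with `φ, φ′ ∈ E(β)`, in which case `β` is the minimal (last) element of `C(φ) = C(φ′)`.
Consequently `Δ₊` is the disjoint union over `β ∈ ℬ` of the sets `E(β)`. -/
theorem statement3 {V : Type*} [NormedAddCommGroup V] [InnerProductSpace ℝ V]
    (R : RootSystemData V) :
    (∀ φ ∈ R.Pos, ∀ φ' ∈ R.Pos, ∀ l l' : List V,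
      R.IsCascadeChainOf φ l → R.IsCascadeChainOf φ' l' →
        ((l = l' ↔ ∃ β ∈ R.cascade, φ ∈ R.E β ∧ φ' ∈ R.E β) ∧
          (l = l' → ∀ β ∈ R.cascade, φ ∈ R.E β → φ' ∈ R.E β → l.getLast? = some β))) ∧
    (R.Pos = ⋃ β ∈ R.cascade, R.E β) ∧
    (∀ β ∈ R.cascade, ∀ β' ∈ R.cascade, β ≠ β' → R.E β ∩ R.E β' = ∅) := by
  refine ⟨fun φ _ φ' _ l l' hl hl' => ?_, ?_, fun β hβ β' hβ' hne => ?_⟩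
  · obtain ⟨β, hβ, hlast, hφ⟩ := hl.exists_getLast
    obtain ⟨β', hβ', hlast', hφ'⟩ := hl'.exists_getLast
    refine ⟨⟨?_, ?_⟩, fun _ γ hγ hφγ _ => ?_⟩
    · rintro rfl
      obtain rfl := Option.some_injective _ (hlast.symm.trans hlast')
      exact ⟨β, hβ, hφ, hφ'⟩
    · rintro ⟨γ, hγ, hφγ, hφγ'⟩
      obtain rfl := RootSystemData.eq_of_mem_E hβ hγ hφ hφγ
      exact hl.1.eq_of_mem_E hl'.1 hlast hlast' hφγ' hφ'
    · rw [hlast, RootSystemData.eq_of_mem_E hβ hγ hφ hφγ]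
  · refine Set.Subset.antisymm (fun φ hφ => ?_)
      (Set.iUnion₂_subset fun β hβ => RootSystemData.E_subset_pos hβ)
    obtain ⟨β, hβ, hmem⟩ := RootSystemData.exists_mem_E hφ
    exact Set.mem_iUnion₂.2 ⟨β, hβ, hmem⟩
  · exact Set.eq_empty_iff_forall_notMem.2 fun φ hφ =>
      hne (RootSystemData.eq_of_mem_E hβ hβ' hφ.1 hφ.2)
end
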